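/- Let m, M, a > 0 with m < (63/8)M, and let L₂ > a/2 be the unique critical point of x ↦ V(x,0) on (a/2, ∞). Then L₂ < 3a/2. -/

import Mathlib

theorem stmt11 (m M a : ℝ) (hm : 0 < m) (hM : 0 < M) (ha : 0 < a)
    (hmM : m < 63/8*M) (L₂ : ℝ) (hL₂ : a/2 < L₂)
    (hcrit : M*L₂/a^3 - m/(4*L₂^2) - M/(2*(L₂+a/2)^2) - M/(2*(L₂-a/2)^2) = 0) :
    L₂ < 3*a/2 := by
  by_contra hcon
  have h : 3*a/2 ≤ L₂ := not_lt.mp hcon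
  have hp : (0:ℝ) < a^2 := by positivity
  have h1 : 3/2*M/a^2 ≤ M*L₂/a^3 := by
    have e : 3/2*M/a^2 = M*(3*a/2)/a^3 := by field_simp
    rw [e]
    gcongr
  have h2 : m/(4*L₂^2) ≤ m/(9*a^2) := by
    apply div_le_div_of_nonneg_left hm.le (by positivity)
    nlinarith
  have h3 : M/(2*(L₂+a/2)^2) ≤ M/(8*a^2) := by
    apply div_le_div_of_nonneg_left hM.le (by positivity)
    nlinarith
  have h4 : M/(2*(L₂-a/2)^2) ≤ M/(2*a^2) := by
    apply div_le_div_of_nonneg_left hM.le (by positivity)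
    nlinarith
  have h5 : 3/2*M/a^2 - m/(9*a^2) - M/(8*a^2) - M/(2*a^2) = (7/8*M - m/9)/a^2 := by
    field_simp
    ring
  have h6 : 0 < (7/8*M - m/9)/a^2 := div_pos (by linarith) hp
  linarith
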